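/- Let X have density f with distribution function F and let Y, independent of X, have density f(·−θ). Let k be a kernel symmetric about the origin with ∫ k = 1 and ∫ t^2 |k(t)| dt < ∞, and K(t) = ∫_{-∞}^t k(u)du. If f is continuously differentiable with bounded derivative, then as h → 0, E[ K((Y − X)/h) ] = ∫_{-∞}^∞ f(y) F(y+θ) dy + O(h^2). Consequently, for the smoothed Wilcoxon statistic W̃_2 = Σ_{i=1}^m Σ_{j=1}^n K((Y_j − X_i)/h), E_θ[W̃_2] = mn [ ∫ f(y) F(y+θ) dy + O(h^2) ]. -/

import Mathlib

open MeasureTheory ProbabilityTheory Filter Asymptotics Set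
open scoped Topology ENNReal NNReal BigOperators

noncomputable section

/-- The `k`-th order statistic (1-indexed) of a finite sample: the smallest point `x`
such that at least `k` of the observations are `≤ x`. -/
def orderStat {N : ℕ} (w : Fin N → ℝ) (k : ℕ) : ℝ :=
  sInf {x : ℝ | k ≤ (Finset.univ.filter fun i => w i ≤ x).card}

/-- The sample median: the `((N+1)/2)`-th order statistic for odd `N`, the average of the
`(N/2)`-th and `(N/2+1)`-th order statistics for even `N`. -/
def sampleMedian {N : ℕ} (w : Fin N → ℝ) : ℝ :=
  if N % 2 = 1 then orderStat w ((N + 1) / 2)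
  else (orderStat w (N / 2) + orderStat w (N / 2 + 1)) / 2

/-- The measure on `ℝ` with Lebesgue density `f`. -/
def densMeasure (f : ℝ → ℝ) : Measure ℝ :=
  MeasureTheory.volume.withDensity fun x => ENNReal.ofReal (f x)

/-- Joint law of the two independent samples: `X_1, …, X_m` i.i.d. with density `f`
and `Y_1, …, Y_n` i.i.d. with density `f(· - θ)`, all independent. -/
def twoSampleLaw (f : ℝ → ℝ) (m n : ℕ) (θ : ℝ) :
    Measure ((Fin m → ℝ) × (Fin n → ℝ)) :=
  (Measure.pi fun _ : Fin m => densMeasure f).prod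
    (Measure.pi fun _ : Fin n => (densMeasure f).map (· + θ))

/-- Integrated kernel `K(t) = ∫_{-∞}^t k(u) du`. -/
def Kfun (k : ℝ → ℝ) (t : ℝ) : ℝ := ∫ u in Set.Iic t, k u

/-- The median test statistic `M† = ∑_{i=1}^m ψ*(Z - X_i)` with `ψ*(x) = 1` for `x > 0`. -/
def MdagStat {m n : ℕ} (p : (Fin m → ℝ) × (Fin n → ℝ)) : ℝ :=
  ∑ i : Fin m, if 0 < sampleMedian (Fin.append p.1 p.2) - p.1 i then (1:ℝ) else 0

/-- The smoothed median test statistic `M̃ = ∑_{i=1}^m K*((Z - X_i)/h)`. -/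
def MtilStat (kstar : ℝ → ℝ) (h : ℝ) {m n : ℕ} (p : (Fin m → ℝ) × (Fin n → ℝ)) : ℝ :=
  ∑ i : Fin m, Kfun kstar ((sampleMedian (Fin.append p.1 p.2) - p.1 i) / h)

/-- The Wilcoxon rank sum statistic `W₂ = ∑_i ∑_j ψ(Y_j - X_i)` with `ψ(x) = 1` for `x ≥ 0`. -/
def W2Stat {m n : ℕ} (p : (Fin m → ℝ) × (Fin n → ℝ)) : ℝ :=
  ∑ i : Fin m, ∑ j : Fin n, if 0 ≤ p.2 j - p.1 i then (1:ℝ) else 0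

/-- The smoothed Wilcoxon statistic `W̃₂ = ∑_i ∑_j K((Y_j - X_i)/h)`. -/
def WtilStat (k : ℝ → ℝ) (h : ℝ) {m n : ℕ} (p : (Fin m → ℝ) × (Fin n → ℝ)) : ℝ :=
  ∑ i : Fin m, ∑ j : Fin n, Kfun k ((p.2 j - p.1 i) / h)

/-- The standard normal distribution function `Φ`. -/
def stdGaussCDF (x : ℝ) : ℝ :=
  ((ProbabilityTheory.gaussianReal 0 1) (Set.Iic x)).toReal

/-- The Beta function `B(a,b) = ∫_0^1 t^{a-1} (1-t)^{b-1} dt`. -/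
def Beta (a b : ℝ) : ℝ := ∫ t in Set.Ioo (0:ℝ) 1, t ^ (a - 1) * (1 - t) ^ (b - 1)

theorem measurable_Kfun {k : ℝ → ℝ} (hk : Integrable k) : Measurable (Kfun k) := by
  have h : ∀ t, Kfun k t = Kfun k 0 + ∫ u in (0:ℝ)..t, k u := fun t => by
    rw [Kfun, Kfun, ← intervalIntegral.integral_Iic_sub_Iic hk.integrableOn hk.integrableOn]
    ring
  rw [funext h]
  exact (continuous_const.add
    (intervalIntegral.continuous_primitive (fun a b => hk.intervalIntegrable) 0)).measurable

theorem abs_Kfun_le {k : ℝ → ℝ} (hk : Integrable k) (t : ℝ) : |Kfun k t| ≤ ∫ u, |k u| :=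
  (norm_integral_le_integral_norm _).trans
    (setIntegral_le_integral hk.norm (Eventually.of_forall fun _ => norm_nonneg _))

theorem integral_densMeasure {f : ℝ → ℝ} (hf : Measurable f) (hf0 : ∀ x, 0 ≤ f x) (g : ℝ → ℝ) :
    ∫ x, g x ∂densMeasure f = ∫ x, f x * g x := by
  rw [densMeasure, integral_withDensity_eq_integral_toReal_smul hf.ennreal_ofReal
    (Eventually.of_forall fun x => ENNReal.ofReal_lt_top)]
  simp [ENNReal.toReal_ofReal (hf0 _)]

theorem isProbabilityMeasure_densMeasure {f : ℝ → ℝ} (hf0 : ∀ x, 0 ≤ f x) (hf : Integrable f)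
    (hfi : ∫ x, f x = 1) : IsProbabilityMeasure (densMeasure f) := by
  constructor
  rw [densMeasure, withDensity_apply _ MeasurableSet.univ, setLIntegral_univ,
    ← ofReal_integral_eq_lintegral_ofReal hf (Eventually.of_forall hf0), hfi, ENNReal.ofReal_one]

theorem measureReal_densMeasure_Iic {f : ℝ → ℝ} (hf0 : ∀ x, 0 ≤ f x) (hf : Integrable f) (x : ℝ) :
    (densMeasure f).real (Iic x) = ∫ t in Iic x, f t := by
  rw [Measure.real, densMeasure, withDensity_apply _ measurableSet_Iic,
    ← ofReal_integral_eq_lintegral_ofReal hf.integrableOn (Eventually.of_forall hf0),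
    ENNReal.toReal_ofReal (integral_nonneg hf0)]

theorem integral_Kfun_sub_div (μ : Measure ℝ) [IsProbabilityMeasure μ] {k : ℝ → ℝ}
    (hk : Integrable k) {h : ℝ} (hh : 0 < h) (y : ℝ) :
    ∫ x, Kfun k ((y - x) / h) ∂μ = ∫ u, k u * μ.real (Iic (y - h * u)) := by
  have hS : MeasurableSet {p : ℝ × ℝ | p.1 ≤ y - h * p.2} :=
    measurableSet_le measurable_fst (by fun_prop)
  have hint : Integrable
      ({p : ℝ × ℝ | p.1 ≤ y - h * p.2}.indicator fun p => k p.2) (μ.prod volume) :=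
    (hk.comp_snd μ).indicator hS
  have hl : ∀ x, Kfun k ((y - x) / h)
      = ∫ u, {p : ℝ × ℝ | p.1 ≤ y - h * p.2}.indicator (fun p => k p.2) (x, u) := fun x => by
    rw [Kfun, ← integral_indicator measurableSet_Iic]
    congr 1 with u
    have : u ≤ (y - x) / h ↔ x ≤ y - h * u := by
      rw [le_div_iff₀ hh]
      constructor <;> intro <;> linarith
    simp [indicator, this]
  simp_rw [hl]
  rw [integral_integral_swap
    (f := fun x u => {p : ℝ × ℝ | p.1 ≤ y - h * p.2}.indicator (fun p => k p.2) (x, u)) hint]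
  congr 1 with u
  have : (fun x => {p : ℝ × ℝ | p.1 ≤ y - h * p.2}.indicator (fun p => k p.2) (x, u))
      = (Iic (y - h * u)).indicator fun _ => k u := by
    ext x
    simp [indicator]
  rw [this, integral_indicator_const _ measurableSet_Iic, smul_eq_mul, mul_comm]

theorem hasDerivAt_integral_Iic {f : ℝ → ℝ} (hf : Integrable f) (hc : Continuous f) (x : ℝ) :
    HasDerivAt (fun x => ∫ t in Iic x, f t) (f x) x := by
  have h : ∀ t, ∫ u in Iic t, f u = (∫ u in Iic 0, f u) + ∫ u in (0:ℝ)..t, f u := fun t => by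
    rw [← intervalIntegral.integral_Iic_sub_Iic hf.integrableOn hf.integrableOn]
    ring
  rw [funext h]
  exact (hc.integral_hasStrictDerivAt 0 x).hasDerivAt.const_add _

theorem abs_sub_linear_le_of_lipschitz_deriv {F f : ℝ → ℝ} (hF : ∀ x, HasDerivAt F (f x) x) {C : ℝ}
    (hf : ∀ x y, |f x - f y| ≤ C * |x - y|) (y s : ℝ) :
    |F (y + s) - F y - s * f y| ≤ C * s ^ 2 := by
  have hC : 0 ≤ C := by simpa using (abs_nonneg _).trans (hf 1 0)
  have hd : ∀ x ∈ uIcc y (y + s),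
      HasDerivWithinAt (fun t => F t - t * f y) (f x - f y) (uIcc y (y + s)) x := fun x _ => by
    have := ((hF x).fun_sub ((hasDerivAt_id' x).mul_const (f y))).hasDerivWithinAt
      (s := uIcc y (y + s))
    rwa [one_mul] at this
  have hb : ∀ x ∈ uIcc y (y + s), ‖f x - f y‖ ≤ C * |s| := fun x hx => by
    refine (hf x y).trans (mul_le_mul_of_nonneg_left ?_ hC)
    simpa using abs_sub_left_of_mem_uIcc hx
  have := (convex_uIcc y (y + s)).norm_image_sub_le_of_norm_hasDerivWithin_le hd hb
    left_mem_uIcc right_mem_uIcc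
  rw [Real.norm_eq_abs, Real.norm_eq_abs, add_sub_cancel_left, mul_assoc, abs_mul_abs_self,
    ← sq] at this
  convert this using 2
  ring

theorem integrable_id_mul_of_sq {k : ℝ → ℝ} (hk : Integrable k)
    (hk2 : Integrable fun t => t ^ 2 * |k t|) : Integrable fun t => t * k t := by
  refine (hk.abs.add hk2).mono' (aestronglyMeasurable_id.mul hk.aestronglyMeasurable)
    (Eventually.of_forall fun t => ?_)
  have : |t| ≤ 1 + t ^ 2 := by nlinarith [sq_abs t, sq_nonneg (|t| - 1)]
  have := mul_le_mul_of_nonneg_right this (abs_nonneg (k t))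
  simp only [Real.norm_eq_abs, abs_mul, Pi.add_apply]
  linarith

theorem integral_id_mul_eq_zero_of_even {k : ℝ → ℝ} (hksym : ∀ t, k (-t) = k t) :
    ∫ t, t * k t = 0 := by
  have := integral_neg_eq_self (fun t => t * k t) volume
  simp only [hksym, neg_mul, integral_neg] at this
  linarith

theorem abs_integral_kernel_mul_sub_le {F f k : ℝ → ℝ} (hF : ∀ x, HasDerivAt F (f x) x) {C : ℝ}
    (hf : ∀ x y, |f x - f y| ≤ C * |x - y|) {B : ℝ} (hB : ∀ x, |F x| ≤ B)
    (hksym : ∀ t, k (-t) = k t) (hk : Integrable k) (hk1 : ∫ t, k t = 1)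
    (hk2 : Integrable fun t => t ^ 2 * |k t|) (h y : ℝ) :
    |(∫ u, k u * F (y - h * u)) - F y| ≤ (C * ∫ t, t ^ 2 * |k t|) * h ^ 2 := by
  have hFc : Continuous F := continuous_iff_continuousAt.2 fun x => (hF x).continuousAt
  have hi1 : Integrable fun u => k u * F (y - h * u) :=
    hk.mul_bdd (c := B) (by fun_prop) (Eventually.of_forall fun u => hB _)
  have hi2 : Integrable fun u => F y * k u := hk.const_mul _
  have hi3 : Integrable fun u => (h * f y) * (u * k u) :=
    (integrable_id_mul_of_sq hk hk2).const_mul _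
  have heq : (∫ u, k u * F (y - h * u)) - F y
      = ∫ u, (k u * F (y - h * u) - F y * k u + (h * f y) * (u * k u)) := by
    rw [integral_add (by exact hi1.sub hi2) hi3, integral_sub hi1 hi2, integral_const_mul,
      integral_const_mul, hk1, integral_id_mul_eq_zero_of_even hksym]
    ring
  rw [heq]
  have hbd : (C * ∫ t, t ^ 2 * |k t|) * h ^ 2 = ∫ t, (C * h ^ 2) * (t ^ 2 * |k t|) := by
    rw [integral_const_mul]
    ring
  rw [hbd, ← Real.norm_eq_abs]
  refine norm_integral_le_of_norm_le (hk2.const_mul _) (Eventually.of_forall fun u => ?_)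
  have := mul_le_mul_of_nonneg_left (abs_sub_linear_le_of_lipschitz_deriv hF hf y (-(h * u)))
    (abs_nonneg (k u))
  rw [← abs_mul] at this
  calc _ = |k u * (F (y + -(h * u)) - F y - -(h * u) * f y)| := by
        rw [Real.norm_eq_abs, ← sub_eq_add_neg]
        congr 1
        ring
    _ ≤ _ := this
    _ = _ := by ring

theorem integrable_Kfun_sub_div (P : Measure (ℝ × ℝ)) [IsFiniteMeasure P] {k : ℝ → ℝ}
    (hk : Integrable k) (h : ℝ) : Integrable (fun p : ℝ × ℝ => Kfun k ((p.2 - p.1) / h)) P :=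
  Integrable.of_bound ((measurable_Kfun hk).comp (by fun_prop)).aestronglyMeasurable
    (∫ u, |k u|) (Eventually.of_forall fun _ => abs_Kfun_le hk _)

theorem integral_WtilStat {f k : ℝ → ℝ} [IsProbabilityMeasure (densMeasure f)] (hk : Integrable k)
    (θ h : ℝ) (m n : ℕ) :
    ∫ p, WtilStat k h p ∂twoSampleLaw f m n θ
      = (m : ℝ) * n * ∫ p : ℝ × ℝ, Kfun k ((p.2 - p.1) / h)
          ∂((densMeasure f).prod ((densMeasure f).map (· + θ))) := by
  have : IsProbabilityMeasure ((densMeasure f).map (· + θ)) :=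
    Measure.isProbabilityMeasure_map (by fun_prop)
  have hmp : ∀ (i : Fin m) (j : Fin n), MeasurePreserving
      (Prod.map (Function.eval i) (Function.eval j)) (twoSampleLaw f m n θ)
      ((densMeasure f).prod ((densMeasure f).map (· + θ))) := fun i j =>
    (measurePreserving_eval (fun _ : Fin m => densMeasure f) i).prod
      (measurePreserving_eval (fun _ : Fin n => (densMeasure f).map (· + θ)) j)
  have hI := integrable_Kfun_sub_div
    ((densMeasure f).prod ((densMeasure f).map (· + θ))) hk h
  have hi : ∀ (i : Fin m) (j : Fin n), Integrable
      (fun p : (Fin m → ℝ) × (Fin n → ℝ) => Kfun k ((p.2 j - p.1 i) / h))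
      (twoSampleLaw f m n θ) := fun i j =>
    (hmp i j).integrable_comp_of_integrable hI
  have hv : ∀ (i : Fin m) (j : Fin n),
      ∫ p, Kfun k ((p.2 j - p.1 i) / h) ∂twoSampleLaw f m n θ
        = ∫ p : ℝ × ℝ, Kfun k ((p.2 - p.1) / h)
            ∂((densMeasure f).prod ((densMeasure f).map (· + θ))) := fun i j => by
    rw [← (hmp i j).map_eq, integral_map (hmp i j).measurable.aemeasurable
      ((hmp i j).map_eq ▸ hI.aestronglyMeasurable)]
    rfl
  simp only [WtilStat]
  rw [integral_finsetSum _ fun i _ => integrable_finsetSum _ fun j _ => hi i j]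
  simp_rw [integral_finsetSum _ fun j _ => hi _ j, hv]
  simp [mul_assoc]

/-- For a symmetric kernel `k` with `∫ k = 1` and finite second absolute
moment, and `f` continuously differentiable with bounded derivative, as `h → 0⁺`,
`E[K((Y-X)/h)] = ∫ f(y) F(y+θ) dy + O(h²)`; consequently
`E_θ[W̃₂] = mn [∫ f(y) F(y+θ) dy + O(h²)]`. -/
theorem stmt_11
    (f : ℝ → ℝ) (hf0 : ∀ x, 0 ≤ f x) (hfi : ∫ x, f x = 1)
    (F : ℝ → ℝ) (hF : ∀ x, F x = ∫ t in Set.Iic x, f t)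
    (hfC : ContDiff ℝ 1 f) (hfd : ∃ C, ∀ x, |deriv f x| ≤ C)
    (k : ℝ → ℝ) (hksym : ∀ t, k (-t) = k t) (hkInt : Integrable k) (hk1 : ∫ t, k t = 1)
    (hk2 : Integrable fun t => t ^ 2 * |k t|) (θ : ℝ) :
    ((fun h : ℝ => (∫ p : ℝ × ℝ, Kfun k ((p.2 - p.1) / h)
          ∂((densMeasure f).prod ((densMeasure f).map (· + θ))))
        - ∫ y, f y * F (y + θ)) =O[𝓝[>] (0:ℝ)] fun h : ℝ => h ^ 2) ∧
    ∀ m n : ℕ,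
      ((fun h : ℝ => (∫ p, WtilStat k h p ∂(twoSampleLaw f m n θ))
          - (m : ℝ) * n * ∫ y, f y * F (y + θ)) =O[𝓝[>] (0:ℝ)] fun h : ℝ => h ^ 2) := by
  obtain ⟨C, hC⟩ := hfd
  have hf : Integrable f := integrable_of_integral_eq_one hfi
  have hprob := isProbabilityMeasure_densMeasure hf0 hf hfi
  have hprob' : IsProbabilityMeasure ((densMeasure f).map (· + θ)) :=
    Measure.isProbabilityMeasure_map (by fun_prop)
  have hFd : ∀ x, HasDerivAt F (f x) x := by
    rw [funext hF]
    exact hasDerivAt_integral_Iic hf hfC.continuous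
  have hFμ : ∀ x, (densMeasure f).real (Iic x) = F x := fun x => by
    rw [hF, measureReal_densMeasure_Iic hf0 hf]
  have hFB : ∀ x, |F x| ≤ 1 := fun x => by
    rw [← hFμ, abs_of_nonneg measureReal_nonneg]
    exact measureReal_le_one
  have hFc : Continuous F := continuous_iff_continuousAt.2 fun x => (hFd x).continuousAt
  have hLip : ∀ x y, |f x - f y| ≤ C * |x - y| := fun x y =>
    convex_univ.norm_image_sub_le_of_norm_deriv_le
      (fun z _ => (hfC.differentiable one_ne_zero) z) (fun z _ => hC z) (mem_univ y) (mem_univ x)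
  have htarget : ∫ y, f y * F (y + θ) = ∫ y, F y ∂(densMeasure f).map (· + θ) := by
    rw [integral_map (by fun_prop) hFc.aestronglyMeasurable,
      integral_densMeasure hfC.continuous.measurable hf0]
  have hmain : (fun h : ℝ => (∫ p : ℝ × ℝ, Kfun k ((p.2 - p.1) / h)
        ∂((densMeasure f).prod ((densMeasure f).map (· + θ))))
      - ∫ y, f y * F (y + θ)) =O[𝓝[>] (0:ℝ)] fun h : ℝ => h ^ 2 := by
    refine IsBigO.of_bound (C * ∫ t, t ^ 2 * |k t|) ?_
    filter_upwards [self_mem_nhdsWithin] with h hh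
    have hI := integrable_Kfun_sub_div
      ((densMeasure f).prod ((densMeasure f).map (· + θ))) hkInt h
    have hFi : Integrable F ((densMeasure f).map (· + θ)) :=
      Integrable.of_bound hFc.aestronglyMeasurable 1 (Eventually.of_forall hFB)
    rw [htarget, integral_prod_symm _ hI, ← integral_sub hI.integral_prod_right hFi,
      Real.norm_of_nonneg (sq_nonneg h)]
    refine (norm_integral_le_of_norm_le_const (C := (C * ∫ t, t ^ 2 * |k t|) * h ^ 2)
      (Eventually.of_forall fun y => ?_)).trans (by simp)
    simp only [integral_Kfun_sub_div _ hkInt hh, hFμ]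
    exact abs_integral_kernel_mul_sub_le hFd hLip hFB hksym hkInt hk1 hk2 h y
  refine ⟨hmain, fun m n => ?_⟩
  simp only [integral_WtilStat hkInt, ← mul_sub]
  exact hmain.const_mul_left _
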